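/- Drift condition implies polynomial moments of first passage times: let Ψ_n be a Markov chain on (X, 𝓑) with transition kernel 𝓟. Suppose there exist a measurable function W : X → [1, ∞), a set A ∈ 𝓑, constants b, c > 0 and 0 ≤ β < 1 such that (𝓟W)(x) − W(x) ≤ −c W(x)^β + b·1_A(x) for all x ∈ X. Then, with β̂ = (1−β)^{−1}, there is a constant ĉ such that for all x ∈ X, E_x[ Σ_{k=0}^{τ_A − 1} (k+1)^{β̂ − 1} ] ≤ ĉ W(x); in particular E_x[τ_A^{β̂}] ≤ β̂ ĉ W(x). -/

import Mathlib

open MeasureTheory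

noncomputable section

/-- `Xp` is a (time-homogeneous) Markov chain on `S` under `ℙ` with one-step transition
kernel `K`: the joint law of `(X_0,…,X_n, X_{n+1})` is the law of `(X_0,…,X_n)`
composed with `K` applied to the last coordinate. -/
def IsMarkovChainWith {Ω : Type} [MeasurableSpace Ω] (ℙ : Measure Ω)
    {S : Type*} [MeasurableSpace S] (K : S → Measure S) (Xp : ℕ → Ω → S) : Prop :=
  (∀ n, Measurable (Xp n)) ∧
  ∀ n : ℕ,
    Measure.map (fun ω => ((fun i : Fin (n+1) => Xp i.1 ω), Xp (n+1) ω)) ℙ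
      = (Measure.map (fun ω => (fun i : Fin (n+1) => Xp i.1 ω)) ℙ).bind
          (fun v => (K (v (Fin.last n))).map (fun z => (v, z)))

/-- The first passage time `τ_A = inf {n > 0 : X_n ∈ A}` (with value `∞` if the set is
never reached), as an extended nonnegative real. -/
def hitTime {Ω : Type} {S : Type*} (Xp : ℕ → Ω → S) (A : Set S) (ω : Ω) : ENNReal :=
  sInf {t : ENNReal | ∃ n : ℕ, t = n ∧ 0 < n ∧ Xp n ω ∈ A}


lemma aux_real_step (w c β : ℝ) (hw : 1 ≤ w) (hc : 0 < c) (hβ0 : 0 ≤ β) (hβ1 : β < 1)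
    (h0 : 0 ≤ w - c * w ^ β) (k : ℕ) :
    ((w - c * w ^ β) ^ (1 - β) + c * (1 - β) / 2 * ((k : ℝ) + 1)) ^ (1 - β)⁻¹
      + c * (1 - β) / 2 * (min 1 (c * (1 - β) / 2)) ^ ((1 - β)⁻¹ - 1)
        * ((k : ℝ) + 1) ^ ((1 - β)⁻¹ - 1)
      ≤ (w ^ (1 - β) + c * (1 - β) / 2 * (k : ℝ)) ^ (1 - β)⁻¹ := by
  have hq : 0 < 1 - β := by linarith
  have hw0 : 0 < w := by linarith
  have hp : 1 ≤ (1 - β)⁻¹ := (one_le_inv₀ hq).2 (by linarith)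
  set p := (1 - β)⁻¹ with hpdef
  set a := c * (1 - β) / 2 with ha
  have ha0 : 0 < a := by positivity
  have hk : (0 : ℝ) ≤ k := Nat.cast_nonneg k
  have hwb : w ^ β = w * w ^ (β - 1) := by
    rw [Real.rpow_sub_one hw0.ne']; field_simp
  have h1 : (w - c * w ^ β) ^ (1 - β) ≤ w ^ (1 - β) - 2 * a := by
    have e : w - c * w ^ β = w * (1 + -(c * w ^ (β - 1))) := by rw [hwb]; ring
    have hs : -1 ≤ -(c * w ^ (β - 1)) := by
      rw [e] at h0
      have := nonneg_of_mul_nonneg_right h0 hw0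
      linarith
    have hb := rpow_one_add_le_one_add_mul_self hs hq.le (by linarith)
    rw [e, Real.mul_rpow hw0.le (by linarith)]
    calc _ ≤ w ^ (1 - β) * (1 + (1 - β) * -(c * w ^ (β - 1))) := by gcongr
      _ = w ^ (1 - β) - (1 - β) * c * (w ^ (1 - β) * w ^ (β - 1)) := by ring
      _ = _ := by rw [← Real.rpow_add hw0]; simp [ha]; ring
  have hl0 : 0 ≤ (w - c * w ^ β) ^ (1 - β) := Real.rpow_nonneg h0 _
  have hw1 : 1 ≤ w ^ (1 - β) := Real.one_le_rpow hw hq.le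
  set y := w ^ (1 - β) + a * k with hy
  have hy1 : 1 + a * k ≤ y := by linarith
  have hak : 0 ≤ a * k := by positivity
  have hya : 0 ≤ y - a := by linarith
  have hy0 : 0 < y := by linarith
  have h2 : ((w - c * w ^ β) ^ (1 - β) + a * ((k : ℝ) + 1)) ^ p ≤ (y - a) ^ p := by
    apply Real.rpow_le_rpow (by positivity) _ (by linarith)
    linarith
  have h3 : (y - a) ^ p ≤ y ^ p - a * y ^ (p - 1) := by
    have e1 : (y - a) ^ p = (y - a) * (y - a) ^ (p - 1) := by
      rcases hya.eq_or_lt with h | h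
      · rw [← h, Real.zero_rpow (by linarith)]; simp
      · rw [Real.rpow_sub_one h.ne']; field_simp
    have e2 : y ^ p = y * y ^ (p - 1) := by
      rw [Real.rpow_sub_one hy0.ne']; field_simp
    rw [e1, e2, ← sub_mul]
    exact mul_le_mul_of_nonneg_left (Real.rpow_le_rpow hya (by linarith) (by linarith)) hya
  have h4 : (min 1 a) ^ (p - 1) * ((k : ℝ) + 1) ^ (p - 1) ≤ y ^ (p - 1) := by
    have hm : 0 < min 1 a := by positivity
    rw [← Real.mul_rpow hm.le (by positivity)]
    apply Real.rpow_le_rpow (by positivity) _ (by linarith)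
    have := min_le_left 1 a
    have := mul_le_mul_of_nonneg_right (min_le_right 1 a) hk
    linarith
  have := mul_le_mul_of_nonneg_left h4 ha0.le
  rw [mul_assoc]
  linarith

lemma aux_real_first (w b a q : ℝ) (hw : 1 ≤ w) (hb : 0 < b) (ha : 0 < a) (hq : 0 < q) :
    ((w + b) ^ q + a) ^ q⁻¹ ≤ ((1 + b) ^ q + a) ^ q⁻¹ * w := by
  have hw0 : 0 < w := by linarith
  have e : w = (w ^ q) ^ q⁻¹ := by rw [← Real.rpow_mul hw0.le, mul_inv_cancel₀ hq.ne', Real.rpow_one]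
  have hw1 : 1 ≤ w ^ q := Real.one_le_rpow hw hq.le
  conv_rhs => rw [e]
  rw [← Real.mul_rpow (by positivity) (by positivity)]
  apply Real.rpow_le_rpow (by positivity) _ (by positivity)
  rw [add_mul, ← Real.mul_rpow (by positivity) (by positivity)]
  gcongr
  · nlinarith
  · nlinarith

lemma aux_minkowski {X : Type*} [MeasurableSpace X] (μ : Measure X) [IsProbabilityMeasure μ]
    (W : X → ℝ) (hWm : Measurable W) (hW0 : ∀ x, 0 ≤ W x) (q s m : ℝ) (hq : 0 < q) (hq1 : q ≤ 1)
    (hs : 0 ≤ s) (hm : 0 ≤ m) (h : ∫⁻ z, ENNReal.ofReal (W z) ∂μ ≤ ENNReal.ofReal m) :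
    ∫⁻ z, ENNReal.ofReal ((W z ^ q + s) ^ q⁻¹) ∂μ ≤ ENNReal.ofReal ((m ^ q + s) ^ q⁻¹) := by
  have hp : 1 ≤ q⁻¹ := (one_le_inv₀ hq).2 hq1
  have hp0 : 0 < q⁻¹ := by positivity
  have key := ENNReal.lintegral_Lp_add_le (μ := μ) (p := q⁻¹)
    (f := fun z => ENNReal.ofReal (W z) ^ q) (g := fun _ => ENNReal.ofReal s)
    (by fun_prop) (by fun_prop) hp
  simp only [one_div, inv_inv, Pi.add_apply, lintegral_const, measure_univ, mul_one,
    ← ENNReal.rpow_mul, mul_inv_cancel₀ hq.ne', inv_mul_cancel₀ hq.ne', ENNReal.rpow_one] at key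
  have e : ∀ t : ℝ, 0 ≤ t → ENNReal.ofReal ((t ^ q + s) ^ q⁻¹) =
      (ENNReal.ofReal t ^ q + ENNReal.ofReal s) ^ q⁻¹ := by
    intro t ht
    have := Real.rpow_nonneg ht q
    rw [ENNReal.ofReal_rpow_of_nonneg ht hq.le, ← ENNReal.ofReal_add this hs,
      ENNReal.ofReal_rpow_of_nonneg (by positivity) hp0.le]
  simp_rw [e _ (hW0 _)]
  rw [e m hm]
  have h2 := key.trans (add_le_add_left (ENNReal.rpow_le_rpow h hq.le) _)
  have h3 := ENNReal.rpow_le_rpow h2 hp0.le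
  rwa [← ENNReal.rpow_mul, mul_inv_cancel₀ hq.ne', ENNReal.rpow_one] at h3

lemma aux_sum_real (p : ℝ) (hp : 1 ≤ p) (n : ℕ) :
    ((n : ℝ)) ^ p ≤ p * ∑ k ∈ Finset.range n, ((k : ℝ) + 1) ^ (p - 1) := by
  induction n with
  | zero => simp [Real.zero_rpow (by linarith : p ≠ 0)]
  | succ n ih =>
    rw [Finset.sum_range_succ, mul_add]
    have hn : (0 : ℝ) < (n : ℝ) + 1 := by positivity
    have hs : -1 ≤ -(((n : ℝ) + 1)⁻¹) := by
      have : ((n : ℝ) + 1)⁻¹ ≤ 1 := inv_le_one_of_one_le₀ (by linarith [Nat.cast_nonneg (α := ℝ) n])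
      linarith
    have hb := one_add_mul_self_le_rpow_one_add hs hp
    have h2 := mul_le_mul_of_nonneg_left hb (Real.rpow_nonneg hn.le p)
    rw [← Real.mul_rpow hn.le (by linarith)] at h2
    have e1 : ((n : ℝ) + 1) * (1 + -((n : ℝ) + 1)⁻¹) = n := by field_simp; ring
    have e2 : ((n : ℝ) + 1) ^ p * (1 + p * -((n : ℝ) + 1)⁻¹) =
      ((n : ℝ) + 1) ^ p - p * ((n : ℝ) + 1) ^ (p - 1) := by
      rw [Real.rpow_sub_one hn.ne']; field_simp; ring
    rw [e1, e2] at h2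
    push_cast
    linarith

lemma aux_markov {Ω : Type} [MeasurableSpace Ω] (ℙ : Measure Ω)
    {S : Type*} [MeasurableSpace S] (K : S → Measure S) (Xp : ℕ → Ω → S)
    (h : IsMarkovChainWith ℙ K Xp) (n : ℕ) (B : Set (Fin (n+1) → S)) (hB : MeasurableSet B)
    (g : S → ENNReal) (hg : Measurable g) :
    ∫⁻ ω, B.indicator (fun _ => g (Xp (n+1) ω)) (fun i : Fin (n+1) => Xp i.1 ω) ∂ℙ
      ≤ ∫⁻ ω, B.indicator (fun _ => ∫⁻ z, g z ∂(K (Xp n ω)))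
          (fun i : Fin (n+1) => Xp i.1 ω) ∂ℙ := by
  obtain ⟨hm, hj⟩ := h
  have hF : Measurable (fun q : (Fin (n+1) → S) × S => B.indicator (fun _ => g q.2) q.1) := by
    have : (fun q : (Fin (n+1) → S) × S => B.indicator (fun _ => g q.2) q.1)
        = (Prod.fst ⁻¹' B).indicator (fun q => g q.2) := by
      rfl
    rw [this]
    exact (hg.comp measurable_snd).indicator (measurable_fst hB)
  have hpath : Measurable (fun ω => (fun i : Fin (n+1) => Xp i.1 ω)) :=
    measurable_pi_lambda _ fun i => hm _
  have e := lintegral_map (μ := ℙ) hF (hpath.prodMk (hm (n+1)))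
  simp only at e
  rw [← e, hj n]
  refine (Measure.lintegral_bind_le _ _ _).trans ((lintegral_map_le _ _).trans ?_)
  refine lintegral_mono fun ω => ?_
  refine (lintegral_map_le _ _).trans ?_
  by_cases hω : (fun i : Fin (n+1) => Xp i.1 ω) ∈ B
  · simp [hω]
  · simp [hω]

lemma aux_lt_hit {Ω : Type} {S : Type*} (Xp : ℕ → Ω → S) (A : Set S) (ω : Ω) (k : ℕ) :
    (k : ENNReal) < hitTime Xp A ω ↔ ∀ i, 0 < i → i ≤ k → Xp i ω ∉ A := by
  constructor
  · intro h i hi hik hA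
    have h1 : hitTime Xp A ω ≤ i := sInf_le ⟨i, rfl, hi, hA⟩
    have h2 : (i : ENNReal) ≤ k := by exact_mod_cast hik
    exact absurd (h1.trans h2) (not_le.2 h)
  · intro h
    have h1 : ((k + 1 : ℕ) : ENNReal) ≤ hitTime Xp A ω := by
      refine le_sInf ?_
      rintro t ⟨n, rfl, hn, hA⟩
      have : k + 1 ≤ n := by
        by_contra hc
        exact h n hn (by omega) hA
      exact_mod_cast this
    refine lt_of_lt_of_le ?_ h1
    exact_mod_cast Nat.lt_succ_self k

lemma aux_hit_pow {Ω : Type} {S : Type*} (Xp : ℕ → Ω → S) (A : Set S) (ω : Ω) (p : ℝ)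
    (hp : 1 ≤ p) :
    (hitTime Xp A ω) ^ p ≤ ENNReal.ofReal p * ∑' k : ℕ,
      (if (k : ENNReal) < hitTime Xp A ω then
        ENNReal.ofReal (((k : ℝ) + 1) ^ (p - 1)) else 0) := by
  have hp0 : 0 < p := by linarith
  have key : ∀ n : ℕ, (n : ENNReal) ≤ hitTime Xp A ω → (n : ENNReal) ^ p ≤
      ENNReal.ofReal p * ∑' k : ℕ, (if (k : ENNReal) < hitTime Xp A ω then
        ENNReal.ofReal (((k : ℝ) + 1) ^ (p - 1)) else 0) := by
    intro n hn
    have h1 : (n : ENNReal) ^ p = ENNReal.ofReal ((n : ℝ) ^ p) := by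
      rw [← ENNReal.ofReal_rpow_of_nonneg (Nat.cast_nonneg n) hp0.le, ENNReal.ofReal_natCast]
    rw [h1]
    refine (ENNReal.ofReal_le_ofReal (aux_sum_real p hp n)).trans ?_
    rw [ENNReal.ofReal_mul hp0.le, ENNReal.ofReal_sum_of_nonneg (fun i _ => by positivity)]
    gcongr
    refine le_trans (le_of_eq ?_) (ENNReal.sum_le_tsum (Finset.range n))
    refine Finset.sum_congr rfl fun k hk => ?_
    rw [if_pos]
    refine lt_of_lt_of_le ?_ hn
    exact_mod_cast Finset.mem_range.1 hk
  by_cases htop : hitTime Xp A ω = ⊤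
  · have hall : ∀ n : ℕ, (n : ENNReal) ≤
      ENNReal.ofReal p * ∑' k : ℕ, (if (k : ENNReal) < hitTime Xp A ω then
        ENNReal.ofReal (((k : ℝ) + 1) ^ (p - 1)) else 0) := by
      intro n
      refine le_trans ?_ (key n (by rw [htop]; exact le_top))
      rcases Nat.eq_zero_or_pos n with h | h
      · simp [h]
      · exact ENNReal.le_rpow_self_of_one_le (by exact_mod_cast h) hp
    rw [ENNReal.eq_top_of_forall_nnreal_le (x := ENNReal.ofReal p * _) ?_]
    · exact le_top
    · intro r
      obtain ⟨n, hn⟩ := exists_nat_ge r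
      exact le_trans (by exact_mod_cast hn) (hall n)
  · have hne : ∃ n : ℕ, 0 < n ∧ Xp n ω ∈ A := by
      by_contra hc
      push Not at hc
      apply htop
      refine ENNReal.eq_top_of_forall_nnreal_le fun r => ?_
      obtain ⟨n, hn⟩ := exists_nat_ge r
      exact le_trans (by exact_mod_cast hn)
        ((aux_lt_hit Xp A ω n).2 fun i hi _ => hc i hi).le
    classical
    have hs := Nat.find_spec hne
    have heq : hitTime Xp A ω = (Nat.find hne : ℕ) := by
      refine le_antisymm (sInf_le ⟨_, rfl, hs.1, hs.2⟩) (le_sInf ?_)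
      rintro t ⟨n, rfl, hn, hA⟩
      exact_mod_cast Nat.find_min' hne ⟨hn, hA⟩
    have := key (Nat.find hne) heq.ge
    conv_lhs => rw [heq]
    exact this

/-- Theorem 3.4; Theorem 3.6 of Jarner–Roberts, drift condition
implies polynomial moments of first passage times. If `𝒫W - W ≤ -c W^β + b 1_A`
with `W ≥ 1`, `b, c > 0`, `0 ≤ β < 1`, then with `β̂ = (1-β)⁻¹` there is `cHat` such that
`E_x[∑_{k=0}^{τ_A - 1} (k+1)^{β̂-1}] ≤ cHat W(x)` for all `x`; in particular
`E_x[τ_A^β̂] ≤ β̂ cHat W(x)`.  (The drift hypothesis is stated as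
`∫ W dK(x,·) ≤ W(x) - c W(x)^β + b 1_A(x)`, which contains the implicit finiteness
of `𝒫W`.) -/
theorem drift_implies_passage_moments
    {X : Type*} [MeasurableSpace X]
    (K : X → Measure X) (hKprob : ∀ x, IsProbabilityMeasure (K x)) (hKmeas : Measurable K)
    (W : X → ℝ) (hWmeas : Measurable W) (hW1 : ∀ x, 1 ≤ W x)
    (A : Set X) (hA : MeasurableSet A)
    (b c : ℝ) (hb : 0 < b) (hc : 0 < c) (β : ℝ) (hβ0 : 0 ≤ β) (hβ1 : β < 1)
    (hdrift : ∀ x : X,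
      ∫⁻ z, ENNReal.ofReal (W z) ∂(K x)
        ≤ ENNReal.ofReal (W x - c * W x ^ β + b * A.indicator (fun _ => (1:ℝ)) x)) :
    ∃ cHat : ℝ, 0 < cHat ∧ ∀ x : X,
      ∀ (Ω : Type) (mΩ : MeasurableSpace Ω) (ℙ : Measure Ω), IsProbabilityMeasure ℙ →
        ∀ Xp : ℕ → Ω → X, IsMarkovChainWith ℙ K Xp → ℙ.map (Xp 0) = Measure.dirac x →
          (∫⁻ ω, ∑' k : ℕ,
              (if (k : ENNReal) < hitTime Xp A ω then
                ENNReal.ofReal (((k : ℝ) + 1) ^ ((1 - β)⁻¹ - 1)) else 0) ∂ℙ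
            ≤ ENNReal.ofReal (cHat * W x)) ∧
          (∫⁻ ω, (hitTime Xp A ω) ^ ((1 - β)⁻¹) ∂ℙ
            ≤ ENNReal.ofReal ((1 - β)⁻¹ * cHat * W x)) := by
  have hq : 0 < 1 - β := by linarith
  have hp : 1 ≤ (1 - β)⁻¹ := (one_le_inv₀ hq).2 (by linarith)
  have hp0 : 0 < (1 - β)⁻¹ := by positivity
  set a : ℝ := c * (1 - β) / 2 with ha
  have ha0 : 0 < a := by positivity
  set δ : ℝ := a * (min 1 a) ^ ((1 - β)⁻¹ - 1) with hδ
  have hδ0 : 0 < δ := by positivity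
  set C : ℝ := ((1 + b) ^ (1 - β) + a) ^ (1 - β)⁻¹ with hC
  have hC0 : 0 < C := by positivity
  have hW0 : ∀ x, 0 ≤ W x := fun x => by linarith [hW1 x]
  -- the right side of the drift condition is nonnegative
  have hrhs : ∀ x, 0 ≤ W x - c * W x ^ β + b * A.indicator (fun _ => (1:ℝ)) x := by
    intro x
    have := hKprob x
    by_contra hneg
    push Not at hneg
    have h1 := hdrift x
    rw [ENNReal.ofReal_of_nonpos hneg.le] at h1
    have h2 : (1 : ENNReal) ≤ ∫⁻ z, ENNReal.ofReal (W z) ∂(K x) := by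
      calc (1 : ENNReal) = ∫⁻ z, 1 ∂(K x) := by simp
        _ ≤ _ := lintegral_mono fun z => by
          simpa using ENNReal.ofReal_le_ofReal (hW1 z)
    exact absurd (h2.trans h1) (by simp)
  let G : ℕ → X → ENNReal := fun k x =>
    ENNReal.ofReal ((W x ^ (1 - β) + a * (k : ℝ)) ^ (1 - β)⁻¹)
  have hGm : ∀ k, Measurable (G k) := by
    intro k
    exact (((hWmeas.pow_const _).add_const _).pow_const _).ennreal_ofReal
  have hstep : ∀ (k : ℕ) (x : X), x ∉ A →
      ∫⁻ z, G (k+1) z ∂(K x) + ENNReal.ofReal (δ * ((k : ℝ) + 1) ^ ((1 - β)⁻¹ - 1)) ≤ G k x := by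
    intro k x hx
    have := hKprob x
    have h0 := hrhs x
    have hd := hdrift x
    simp only [Set.indicator_of_notMem hx, mul_zero, add_zero] at h0 hd
    have h1 := aux_minkowski (K x) W hWmeas hW0 (1 - β) (a * ((k : ℝ) + 1)) _ hq (by linarith)
      (by positivity) h0 hd
    have h2 := aux_real_step (W x) c β (hW1 x) hc hβ0 hβ1 h0 k
    have h3 : 0 ≤ (W x - c * W x ^ β) ^ (1 - β) := Real.rpow_nonneg h0 _
    simp only [G]
    push_cast
    refine (add_le_add_left h1 _).trans ?_
    rw [← ENNReal.ofReal_add (by positivity) (by positivity)]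
    exact ENNReal.ofReal_le_ofReal h2
  have hfirst : ∀ x, ∫⁻ z, G 1 z ∂(K x) ≤ ENNReal.ofReal (C * W x) := by
    intro x
    have := hKprob x
    have hd : ∫⁻ z, ENNReal.ofReal (W z) ∂(K x) ≤ ENNReal.ofReal (W x + b) := by
      refine (hdrift x).trans (ENNReal.ofReal_le_ofReal ?_)
      have h1 : A.indicator (fun _ => (1:ℝ)) x ≤ 1 := by
        by_cases hx : x ∈ A <;> simp [hx]
      have h2 : 0 ≤ c * W x ^ β := mul_nonneg hc.le (Real.rpow_nonneg (hW0 x) _)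
      nlinarith
    have h1 := aux_minkowski (K x) W hWmeas hW0 (1 - β) a _ hq (by linarith)
      ha0.le (by linarith [hW0 x]) hd
    simp only [G, Nat.cast_one, mul_one]
    exact h1.trans (ENNReal.ofReal_le_ofReal (aux_real_first (W x) b a (1 - β) (hW1 x) hb ha0 hq))
  refine ⟨1 + C / δ, by positivity, ?_⟩
  intro x Ω mΩ ℙ hℙ Xp hXp hX0
  have hm := hXp.1
  let E : ℕ → Set Ω := fun k => {ω | ∀ i, 0 < i → i ≤ k → Xp i ω ∉ A}
  have hE : ∀ k, MeasurableSet (E k) := by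
    intro k
    have : E k = ⋂ i : ℕ, ⋂ (_ : 0 < i), ⋂ (_ : i ≤ k), (Xp i ⁻¹' A)ᶜ := by
      ext ω; simp [E]
    rw [this]
    exact MeasurableSet.iInter fun i => MeasurableSet.iInter fun _ => MeasurableSet.iInter fun _ =>
      (hm i hA).compl
  have hmk : ∀ (k : ℕ) (g : X → ENNReal), Measurable g →
      ∫⁻ ω, (E k).indicator (fun ω => g (Xp (k+1) ω)) ω ∂ℙ
        ≤ ∫⁻ ω, (E k).indicator (fun ω => ∫⁻ z, g z ∂(K (Xp k ω))) ω ∂ℙ := by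
    intro k g hg
    let B : Set (Fin (k+1) → X) := {v | ∀ i, 0 < i.1 → v i ∉ A}
    have hB : MeasurableSet B := by
      have : B = ⋂ i : Fin (k+1), ⋂ (_ : 0 < i.1), ((fun v : Fin (k+1) → X => v i) ⁻¹' A)ᶜ := by
        ext v; simp [B]
      rw [this]
      exact MeasurableSet.iInter fun i => MeasurableSet.iInter fun _ =>
        (measurable_pi_apply i hA).compl
    have hiff : ∀ ω, (fun i : Fin (k+1) => Xp i.1 ω) ∈ B ↔ ω ∈ E k := by
      intro ω
      constructor
      · intro h i hi hik
        exact h ⟨i, by omega⟩ hi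
      · intro h i hi
        exact h i.1 hi (by omega)
    have h := aux_markov ℙ K Xp hXp k B hB g hg
    have hind : ∀ (f : Ω → ENNReal) (ω : Ω), (E k).indicator f ω
        = B.indicator (fun _ => f ω) (fun i : Fin (k+1) => Xp i.1 ω) := by
      intro f ω
      by_cases hω : ω ∈ E k
      · rw [Set.indicator_of_mem hω, Set.indicator_of_mem ((hiff ω).2 hω)]
      · rw [Set.indicator_of_notMem hω, Set.indicator_of_notMem (fun h' => hω ((hiff ω).1 h'))]
    simp only [hind]
    exact h
  let e : ℕ → ENNReal := fun k => ∫⁻ ω, (E k).indicator (fun ω => G k (Xp k ω)) ω ∂ℙ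
  let r : ℕ → ENNReal := fun k => ENNReal.ofReal (((k : ℝ) + 1) ^ ((1 - β)⁻¹ - 1))
  have hX0ae : ∀ᵐ ω ∂ℙ, ∫⁻ z, G 1 z ∂(K (Xp 0 ω)) ≤ ENNReal.ofReal (C * W x) := by
    have hms : Measurable fun y => ∫⁻ z, G 1 z ∂(K y) :=
      (Measure.measurable_lintegral (hGm 1)).comp hKmeas
    have h1 : ∀ᵐ y ∂(ℙ.map (Xp 0)), ∫⁻ z, G 1 z ∂(K y) ≤ ENNReal.ofReal (C * W x) := by
      rw [hX0]
      exact (ae_dirac_iff (measurableSet_le hms measurable_const)).2 (hfirst x)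
    exact ae_of_ae_map (hm 0).aemeasurable h1
  have hEmono : ∀ k, E (k+1) ⊆ E k := fun k ω h i hi hik => h i hi (by omega)
  have he1 : e 1 ≤ ENNReal.ofReal (C * W x) := by
    calc e 1 ≤ ∫⁻ ω, (E 0).indicator (fun ω => G 1 (Xp 1 ω)) ω ∂ℙ :=
          lintegral_mono fun ω => Set.indicator_le_indicator_of_subset (hEmono 0) (fun _ => zero_le) ω
      _ ≤ ∫⁻ ω, (E 0).indicator (fun ω => ∫⁻ z, G 1 z ∂(K (Xp 0 ω))) ω ∂ℙ := hmk 0 _ (hGm 1)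
      _ ≤ ∫⁻ ω, ENNReal.ofReal (C * W x) ∂ℙ := by
          refine lintegral_mono_ae ?_
          filter_upwards [hX0ae] with ω hω
          exact (Set.indicator_le_self _ _ ω).trans hω
      _ = _ := by simp
  have hes : ∀ k, e (k+2) + ENNReal.ofReal δ * (r (k+1) * ℙ (E (k+1))) ≤ e (k+1) := by
    intro k
    calc e (k+2) + ENNReal.ofReal δ * (r (k+1) * ℙ (E (k+1)))
        ≤ ∫⁻ ω, (E (k+1)).indicator (fun ω => ∫⁻ z, G (k+2) z ∂(K (Xp (k+1) ω))) ω ∂ℙ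
          + ∫⁻ ω, (E (k+1)).indicator (fun _ => ENNReal.ofReal δ * r (k+1)) ω ∂ℙ := by
          refine add_le_add ?_ ?_
          · refine le_trans (lintegral_mono fun ω => ?_) (hmk (k+1) _ (hGm (k+2)))
            exact Set.indicator_le_indicator_of_subset (hEmono (k+1)) (fun _ => zero_le) ω
          · rw [lintegral_indicator_const (hE _), mul_assoc]
      _ = ∫⁻ ω, ((E (k+1)).indicator (fun ω => ∫⁻ z, G (k+2) z ∂(K (Xp (k+1) ω))) ω
          + (E (k+1)).indicator (fun _ => ENNReal.ofReal δ * r (k+1)) ω) ∂ℙ := by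
          rw [lintegral_add_right _ (measurable_const.indicator (hE _))]
      _ ≤ e (k+1) := by
          refine lintegral_mono fun ω => ?_
          by_cases hω : ω ∈ E (k+1)
          · simp only [Set.indicator_of_mem hω]
            have := hstep (k+1) (Xp (k+1) ω) (hω (k+1) (by omega) le_rfl)
            rw [ENNReal.ofReal_mul hδ0.le] at this
            exact this
          · simp [Set.indicator_of_notMem hω]
  have hsum : ∀ n, e (n+1) + ENNReal.ofReal δ *
      ∑ k ∈ Finset.range n, r (k+1) * ℙ (E (k+1)) ≤ ENNReal.ofReal (C * W x) := by
    intro n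
    induction n with
    | zero => simpa using he1
    | succ n ih =>
      rw [Finset.sum_range_succ, mul_add]
      refine le_trans ?_ ih
      rw [add_comm (ENNReal.ofReal δ * _), ← add_assoc]
      exact add_le_add_left (hes n) _
  have htail : ∑' k, r (k+1) * ℙ (E (k+1)) ≤ ENNReal.ofReal (C / δ * W x) := by
    refine ENNReal.tsum_le_of_sum_range_le fun n => ?_
    have h1 := le_trans le_add_self (hsum n)
    have h2 : C / δ * W x = (C * W x) / δ := by ring
    rw [h2, ENNReal.ofReal_div_of_pos hδ0]
    rw [ENNReal.le_div_iff_mul_le (Or.inl (by simpa using hδ0)) (Or.inl ENNReal.ofReal_ne_top),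
      mul_comm]
    exact h1
  have hmain : ∫⁻ ω, ∑' k : ℕ,
              (if (k : ENNReal) < hitTime Xp A ω then
                ENNReal.ofReal (((k : ℝ) + 1) ^ ((1 - β)⁻¹ - 1)) else 0) ∂ℙ
            ≤ ENNReal.ofReal ((1 + C / δ) * W x) := by
    have h1 : ∀ ω, (∑' k : ℕ, (if (k : ENNReal) < hitTime Xp A ω then
                ENNReal.ofReal (((k : ℝ) + 1) ^ ((1 - β)⁻¹ - 1)) else 0))
          = ∑' k : ℕ, (E k).indicator (fun _ => r k) ω := by
      intro ω
      refine tsum_congr fun k => ?_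
      by_cases hω : ω ∈ E k
      · rw [Set.indicator_of_mem hω, if_pos ((aux_lt_hit Xp A ω k).2 hω)]
      · rw [Set.indicator_of_notMem hω, if_neg (fun h' => hω ((aux_lt_hit Xp A ω k).1 h'))]
    simp_rw [h1]
    rw [lintegral_tsum fun k => (measurable_const.indicator (hE k)).aemeasurable]
    simp_rw [fun k => lintegral_indicator_const (μ := ℙ) (hE k) (r k)]
    rw [tsum_eq_zero_add' ENNReal.summable, add_mul, one_mul,
      ENNReal.ofReal_add (hW0 x) (mul_nonneg (by positivity) (hW0 x))]
    refine add_le_add ?_ htail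
    have : r 0 = 1 := by simp [r]
    rw [this, one_mul]
    refine prob_le_one.trans ?_
    simpa using ENNReal.ofReal_le_ofReal (hW1 x)
  refine ⟨hmain, ?_⟩
  calc ∫⁻ ω, (hitTime Xp A ω) ^ ((1 - β)⁻¹) ∂ℙ
      ≤ ∫⁻ ω, ENNReal.ofReal (1 - β)⁻¹ * ∑' k : ℕ,
              (if (k : ENNReal) < hitTime Xp A ω then
                ENNReal.ofReal (((k : ℝ) + 1) ^ ((1 - β)⁻¹ - 1)) else 0) ∂ℙ :=
        lintegral_mono fun ω => aux_hit_pow Xp A ω _ hp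
    _ = ENNReal.ofReal (1 - β)⁻¹ * ∫⁻ ω, ∑' k : ℕ,
              (if (k : ENNReal) < hitTime Xp A ω then
                ENNReal.ofReal (((k : ℝ) + 1) ^ ((1 - β)⁻¹ - 1)) else 0) ∂ℙ :=
        lintegral_const_mul' _ _ ENNReal.ofReal_ne_top
    _ ≤ ENNReal.ofReal (1 - β)⁻¹ * ENNReal.ofReal ((1 + C / δ) * W x) := by gcongr
    _ = _ := by rw [← ENNReal.ofReal_mul hp0.le, mul_assoc]

end
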